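/- Let n ∈ ℕ and let I ⊆ ℝ be an interval. If f : I → ℝ is both n-convex and n-concave, then f agrees on I with a polynomial of degree at most n. -/

import Mathlib

/-- Lagrange basis coefficient: `lagC t z i = ∏_{j ≠ i} (t - z j)/(z i - z j)`. -/
noncomputable def lagC {m : ℕ} (t : ℝ) (z : Fin m → ℝ) (i : Fin m) : ℝ :=
  ∏ j ∈ Finset.univ.erase i, (t - z j) / (z i - z j)

/-- `f` is `n`-convex on `I`: for all `x₀ < x₁ < ⋯ < x_{n+1}` in `I`,
`(-1)^n f(x₀) ≤ (-1)^n ∑ᵢ cᵢ(x₀; x₁,…,x_{n+1}) f(xᵢ)`. -/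
def NConvexOn (n : ℕ) (I : Set ℝ) (f : ℝ → ℝ) : Prop :=
  ∀ x : Fin (n + 2) → ℝ, (∀ i, x i ∈ I) → StrictMono x →
    (-1 : ℝ) ^ n * f (x 0) ≤
      (-1 : ℝ) ^ n * ∑ i : Fin (n + 1), lagC (x 0) (fun j => x j.succ) i * f (x i.succ)

/-- `f` is `n`-concave on `I` iff `-f` is `n`-convex on `I`. -/
def NConcaveOn (n : ℕ) (I : Set ℝ) (f : ℝ → ℝ) : Prop :=
  NConvexOn n I (fun t => -f t)

open Polynomial in
/-- The Lagrange coefficients `lagC t z i` are the weights in the value at `t` of the Lagrange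
interpolant with nodes `z`. -/
theorem eval_interpolate_eq_sum_lagC {m : ℕ} (t : ℝ) (z r : Fin m → ℝ) :
    (Lagrange.interpolate Finset.univ z r).eval t = ∑ i, lagC t z i * r i := by
  rw [Lagrange.interpolate_apply, eval_finsetSum]
  refine Finset.sum_congr rfl fun i _ => ?_
  rw [eval_mul, eval_C, mul_comm, Lagrange.basis, eval_prod, lagC]
  congr 1
  refine Finset.prod_congr rfl fun j _ => ?_
  simp [Lagrange.basisDivisor, div_eq_inv_mul]

/-- A function that is both `n`-convex and `n`-concave satisfies the defining inequality with
equality. -/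
theorem NConvexOn.eq_sum_lagC {n : ℕ} {I : Set ℝ} {f : ℝ → ℝ} (hf : NConvexOn n I f)
    (hf' : NConcaveOn n I f) {x : Fin (n + 2) → ℝ} (hx : ∀ i, x i ∈ I) (hmono : StrictMono x) :
    f (x 0) = ∑ i : Fin (n + 1), lagC (x 0) (fun j => x j.succ) i * f (x i.succ) := by
  have h₁ := hf x hx hmono
  have h₂ := hf' x hx hmono
  simp only [mul_neg, Finset.sum_neg_distrib, neg_le_neg_iff] at h₂
  exact mul_left_cancel₀ (pow_ne_zero n (by norm_num : (-1 : ℝ) ≠ 0)) (h₁.antisymm h₂)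

/-- A function that is both `n`-convex and `n`-concave agrees with a polynomial of degree at most
`n` on every subset of cardinality `n + 2`. -/
theorem NConvexOn.exists_polynomial_eqOn_finset {n : ℕ} {I : Set ℝ} {f : ℝ → ℝ}
    (hf : NConvexOn n I f) (hf' : NConcaveOn n I f) {S : Finset ℝ} (hS : (S : Set ℝ) ⊆ I)
    (hcard : S.card = n + 2) :
    ∃ p : Polynomial ℝ, p.degree < (n + 1 : ℕ) ∧ ∀ y ∈ S, f y = p.eval y := by
  set x : Fin (n + 2) → ℝ := ⇑(S.orderEmbOfFin hcard) with hx
  have hmono : StrictMono x := (S.orderEmbOfFin hcard).strictMono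
  have hinj : Set.InjOn (fun j : Fin (n + 1) => x j.succ) (Finset.univ : Finset (Fin (n + 1))) :=
    (hmono.injective.comp (Fin.succ_injective _)).injOn
  refine ⟨Lagrange.interpolate Finset.univ (fun j : Fin (n + 1) => x j.succ)
    (fun j => f (x j.succ)), ?_, fun y hy => ?_⟩
  · simpa using Lagrange.degree_interpolate_lt (fun j : Fin (n + 1) => f (x j.succ)) hinj
  · obtain ⟨i, rfl⟩ : ∃ i, x i = y := by
      rwa [← Set.mem_range, hx, Finset.range_orderEmbOfFin, Finset.mem_coe]
    cases i using Fin.cases with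
    | zero =>
      rw [eval_interpolate_eq_sum_lagC]
      exact hf.eq_sum_lagC hf' (fun i => hS (S.orderEmbOfFin_mem hcard i)) hmono
    | succ j =>
      exact (Lagrange.eval_interpolate_at_node (fun j : Fin (n + 1) => f (x j.succ)) hinj
        (Finset.mem_univ j)).symm

/-- If `f` is both `n`-convex and `n`-concave on the interval `I`, then `f` agrees
on `I` with a polynomial of degree at most `n`. -/
theorem stmt_9 (n : ℕ) (I : Set ℝ) (hI : I.OrdConnected) (f : ℝ → ℝ)
    (hconvex : NConvexOn n I f) (hconcave : NConcaveOn n I f) :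
    ∃ w : Polynomial ℝ, w.natDegree ≤ n ∧ ∀ x ∈ I, f x = w.eval x := by
  classical
  have hnat {p : Polynomial ℝ} (hp : p.degree < (n + 1 : ℕ)) : p.natDegree ≤ n :=
    Polynomial.natDegree_le_iff_coeff_eq_zero.2
      ((Polynomial.degree_lt_iff_coeff_zero p (n + 1)).1 hp)
  by_cases h : ∃ T : Finset ℝ, (T : Set ℝ) ⊆ I ∧ T.card = n + 1
  · obtain ⟨T, hTI, hT⟩ := h
    have hdeg : (Lagrange.interpolate T id f).degree < (n + 1 : ℕ) :=
      hT ▸ Lagrange.degree_interpolate_lt f Function.injective_id.injOn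
    refine ⟨Lagrange.interpolate T id f, hnat hdeg, fun x hx => ?_⟩
    by_cases hxT : x ∈ T
    · exact (Lagrange.eval_interpolate_at_node f Function.injective_id.injOn hxT).symm
    · obtain ⟨p, hp, hpf⟩ := hconvex.exists_polynomial_eqOn_finset hconcave
        (S := insert x T) (by simpa [Set.insert_subset_iff] using ⟨hx, hTI⟩)
        (by rw [Finset.card_insert_of_notMem hxT, hT])
      rw [← Lagrange.eq_interpolate_of_eval_eq f Function.injective_id.injOn (hT ▸ hp)
        fun y hy => (hpf y (Finset.mem_insert_of_mem hy)).symm]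
      exact hpf x (Finset.mem_insert_self x T)
  · have hfin : I.Finite := by
      by_contra hinf
      exact h (Set.Infinite.exists_subset_card_eq hinf (n + 1))
    have hcard : hfin.toFinset.card ≤ n + 1 := by
      by_contra! hlt
      obtain ⟨T, hT, hTn⟩ := Finset.exists_subset_card_eq hlt.le
      exact h ⟨T, fun y hy => hfin.mem_toFinset.1 (hT hy), hTn⟩
    refine ⟨Lagrange.interpolate hfin.toFinset id f, hnat ?_, fun x hx => ?_⟩
    · exact (Lagrange.degree_interpolate_lt f Function.injective_id.injOn).trans_le
        (by exact_mod_cast hcard)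
    · exact (Lagrange.eval_interpolate_at_node f Function.injective_id.injOn
        (hfin.mem_toFinset.2 hx)).symm
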